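/- Let R = ℤ(+)(ℤ/2ℤ)^(ℕ) and S = {(2,0)ⁿ : n ≥ 0}. Then the principal ideal generated by (2,0) is not c-S-finitely presented; consequently R is not a c-S-coherent ring. -/

import Mathlib

open Function LinearMap

noncomputable instance : Module ℤᵐᵒᵖ (ℕ →₀ ZMod 2) :=
  Module.compHom _ ((RingEquiv.toOpposite ℤ).symm : ℤᵐᵒᵖ →+* ℤ)

instance : IsCentralScalar ℤ (ℕ →₀ ZMod 2) := ⟨fun _ _ => rfl⟩


/-- A module `M` is `S`-finite: there is a f.g. submodule `N₀` and `s ∈ S` with `s • M ⊆ N₀`. -/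
def SFiniteMod (R : Type*) [CommRing R] (S : Submonoid R)
    (M : Type*) [AddCommGroup M] [Module R M] : Prop :=
  ∃ N₀ : Submodule R M, N₀.FG ∧ ∃ s ∈ S, ∀ m : M, s • m ∈ N₀

/-- A module `M` is `S`-finitely presented: there is an exact sequence
`0 → K → F → M → 0` with `F` finitely generated free and `K` `S`-finite. -/
def SFinitePres (R : Type*) [CommRing R] (S : Submonoid R)
    (M : Type*) [AddCommGroup M] [Module R M] : Prop :=
  ∃ (n : ℕ) (f : (Fin n → R) →ₗ[R] M), Function.Surjective f ∧
    ∃ K₀ : Submodule R (Fin n → R), K₀.FG ∧ K₀ ≤ LinearMap.ker f ∧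
      ∃ s ∈ S, ∀ x ∈ LinearMap.ker f, s • x ∈ K₀

/-- An ideal `I` is `S`-finite. -/
def SFiniteIdeal (R : Type*) [CommRing R] (S : Submonoid R) (I : Ideal R) : Prop :=
  ∃ J : Ideal R, J.FG ∧ J ≤ I ∧ ∃ s ∈ S, ∀ x ∈ I, s * x ∈ J

/-- `R` is an `S`-coherent ring: every finitely generated ideal is `S`-finitely presented. -/
def SCoherentRing (R : Type*) [CommRing R] (S : Submonoid R) : Prop :=
  ∀ I : Ideal R, I.FG → SFinitePres R S ↥I

/-- `M` is an `S`-coherent module: finitely generated and every finitely generated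
submodule is `S`-finitely presented. -/
def SCoherentMod (R : Type*) [CommRing R] (S : Submonoid R)
    (M : Type*) [AddCommGroup M] [Module R M] : Prop :=
  Module.Finite R M ∧ ∀ N : Submodule R M, N.FG → SFinitePres R S ↥N

/-- A module `M` is c-S-finitely presented. -/
def CSFinitePresMod (R : Type*) [CommRing R] (S : Submonoid R)
    (M : Type*) [AddCommGroup M] [Module R M] : Prop :=
  ∃ N : Submodule R M, Module.FinitePresentation R ↥N ∧ ∃ s ∈ S, ∀ m : M, s • m ∈ N

/-- An ideal `I` is c-S-finitely presented. -/
def CSFiniteIdeal (R : Type*) [CommRing R] (S : Submonoid R) (I : Ideal R) : Prop :=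
  ∃ J : Ideal R, J ≤ I ∧ Module.FinitePresentation R ↥J ∧ ∃ s ∈ S, ∀ x ∈ I, s * x ∈ J

/-- `R` is c-S-coherent. -/
def CSCoherentRing (R : Type*) [CommRing R] (S : Submonoid R) : Prop :=
  ∀ I : Ideal R, I.FG → CSFiniteIdeal R S I

/-- Elements `(0, b)` with `b` supported in `T`. -/
def suppIdeal (T : Finset ℕ) : Ideal (TrivSqZeroExt ℤ (ℕ →₀ ZMod 2)) where
  carrier := {x | x.fst = 0 ∧ ∀ i ∉ T, x.snd i = 0}
  zero_mem' := by simp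
  add_mem' := by
    rintro a b ⟨ha, ha'⟩ ⟨hb, hb'⟩
    refine ⟨by simp [ha, hb], fun i hi => by simp [ha' i hi, hb' i hi]⟩
  smul_mem' := by
    rintro c x ⟨hx, hx'⟩
    refine ⟨by simp [hx], fun i hi => ?_⟩
    simp [hx, hx' i hi]

theorem not_fg_aux (K : Ideal (TrivSqZeroExt ℤ (ℕ →₀ ZMod 2)))
    (hK : ∀ x, x ∈ K ↔ x.fst = 0) : ¬ K.FG := by
  classical
  rintro ⟨s, hs⟩
  have hle : K ≤ suppIdeal (s.biUnion fun x => x.snd.support) := by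
    rw [← hs]
    refine Ideal.span_le.2 fun x hx => ⟨(hK x).1 (hs ▸ Ideal.subset_span hx), fun i hi => ?_⟩
    by_contra h
    exact hi (Finset.mem_biUnion.2 ⟨x, hx, Finsupp.mem_support_iff.2 h⟩)
  obtain ⟨i, hi⟩ := Infinite.exists_notMem_finset (s.biUnion fun x => x.snd.support)
  have h1 : (TrivSqZeroExt.inr (Finsupp.single i 1) : TrivSqZeroExt ℤ (ℕ →₀ ZMod 2)) ∈ K :=
    (hK _).2 (by simp)
  have h2 := (hle h1).2 i hi
  simp at h2

theorem two_smul_aux (b : ℕ →₀ ZMod 2) (m : ℤ) : (2 * m) • b = 0 := by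
  ext i
  rw [Finsupp.smul_apply, zsmul_eq_mul]
  have : (2 : ZMod 2) = 0 := by decide
  push_cast
  simp [this]

theorem stmt15_aux :
    ¬ CSFiniteIdeal (TrivSqZeroExt ℤ (ℕ →₀ ZMod 2))
        (Submonoid.powers (2 : TrivSqZeroExt ℤ (ℕ →₀ ZMod 2)))
        (Ideal.span {(2 : TrivSqZeroExt ℤ (ℕ →₀ ZMod 2))}) := by
  rintro ⟨J, hJ, hfp, s, ⟨n, rfl⟩, hs⟩
  have h2 : (2 : TrivSqZeroExt ℤ (ℕ →₀ ZMod 2)) = TrivSqZeroExt.inl 2 := rfl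
  have hform : ∀ x ∈ J, ∃ m : ℤ, x = TrivSqZeroExt.inl (2 * m) := by
    intro x hx
    obtain ⟨y, rfl⟩ := Ideal.mem_span_singleton.1 (hJ hx)
    refine ⟨y.fst, ?_⟩
    rw [h2]
    ext i
    · simp
    · have := DFunLike.congr_fun (two_smul_aux y.snd 1) i
      simpa using this
  obtain ⟨d, hd⟩ := (IsPrincipalIdealRing.principal
    (J.comap (TrivSqZeroExt.inlHom ℤ (ℕ →₀ ZMod 2)))).principal
  have hdJ : (TrivSqZeroExt.inl d : TrivSqZeroExt ℤ (ℕ →₀ ZMod 2)) ∈ J := by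
    have : d ∈ J.comap (TrivSqZeroExt.inlHom ℤ (ℕ →₀ ZMod 2)) := by
      rw [hd]; exact Submodule.mem_span_singleton_self d
    exact this
  have hgen : ∀ m : ℤ, (TrivSqZeroExt.inl m : TrivSqZeroExt ℤ (ℕ →₀ ZMod 2)) ∈ J → d ∣ m := by
    intro m hm
    have : m ∈ J.comap (TrivSqZeroExt.inlHom ℤ (ℕ →₀ ZMod 2)) := hm
    rw [hd] at this
    exact Ideal.mem_span_singleton.1 this
  have hd0 : d ≠ 0 := by
    rintro rfl
    have h := hs 2 (Ideal.mem_span_singleton_self _)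
    have h' : (TrivSqZeroExt.inl (2 ^ n * 2) : TrivSqZeroExt ℤ (ℕ →₀ ZMod 2)) ∈ J := by
      rw [TrivSqZeroExt.inl_mul, ← TrivSqZeroExt.inl_pow]
      exact h
    have := zero_dvd_iff.1 (hgen _ h')
    simp at this
  obtain ⟨m, hm⟩ := hform _ hdJ
  have hdm : d = 2 * m := TrivSqZeroExt.inl_injective hm
  let f : TrivSqZeroExt ℤ (ℕ →₀ ZMod 2) →ₗ[TrivSqZeroExt ℤ (ℕ →₀ ZMod 2)] J :=
    LinearMap.toSpanSingleton _ J ⟨TrivSqZeroExt.inl d, hdJ⟩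
  have hf : Function.Surjective f := by
    rintro ⟨x, hx⟩
    obtain ⟨k, rfl⟩ := hform x hx
    obtain ⟨c, hc⟩ := hgen _ hx
    refine ⟨TrivSqZeroExt.inl c, Subtype.ext ?_⟩
    change TrivSqZeroExt.inl c * TrivSqZeroExt.inl d = TrivSqZeroExt.inl (2 * k)
    rw [← TrivSqZeroExt.inl_mul, hc, mul_comm]
  refine not_fg_aux (LinearMap.ker f) ?_ (Module.FinitePresentation.fg_ker f hf)
  intro x
  rw [LinearMap.mem_ker, Subtype.ext_iff]
  change x * TrivSqZeroExt.inl d = 0 ↔ _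
  constructor
  · intro h
    have := congrArg TrivSqZeroExt.fst h
    simpa [hd0] using this
  · intro h
    ext i
    · simp [h]
    · have := DFunLike.congr_fun (two_smul_aux x.snd m) i
      rw [← hdm] at this
      simpa [h] using this

/-- In `R = ℤ(+)(ℤ/2ℤ)^(ℕ)` with `S = {(2,0)ⁿ}`, the principal ideal `⟨(2,0)⟩` is
not c-S-finitely presented; consequently `R` is not c-S-coherent. -/
theorem stmt15 :
    ¬ CSFiniteIdeal (TrivSqZeroExt ℤ (ℕ →₀ ZMod 2))
        (Submonoid.powers (2 : TrivSqZeroExt ℤ (ℕ →₀ ZMod 2)))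
        (Ideal.span {(2 : TrivSqZeroExt ℤ (ℕ →₀ ZMod 2))}) ∧
    ¬ CSCoherentRing (TrivSqZeroExt ℤ (ℕ →₀ ZMod 2))
        (Submonoid.powers (2 : TrivSqZeroExt ℤ (ℕ →₀ ZMod 2))) :=
  ⟨stmt15_aux, fun h => stmt15_aux (h _ ⟨{2}, by simp⟩)⟩
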